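/- Let a ∈ ℝ and let R be an algebraic curvature tensor on ℝ³ with ric 2 3 = 0. Let S be the linear endomorphism of symmetric 3×3 real matrices given by S(h) i k = h i k + δ i 1 · δ k 1 · (Σ_j h j j) − δ i 1 · h 1 k − δ k 1 · h 1 i + a · δ i 1 · Σ_{s,u} (R k s 1 u) · h s u − a · Σ_u (R k 1 1 u) · h i u + a · δ k 1 · Σ_{s,u} (R i s 1 u) · h s u − a · Σ_u (R i 1 1 u) · h k u, and define the DeTurck-modified operator S' by S'(h) 1 1 = S(h) 1 1 + h 1 1 − h 2 2 − h 3 3, S'(h) 1 k = S(h) 1 k + h 1 k for k ∈ {2,3} (and symmetrically S'(h) k 1), and S'(h) i k = S(h) i k for i, k ∈ {2,3}. Then the characteristic polynomial of S' equals (X − 1)³ · (X − λ₁) · (X − λ₂) · (X − λ₃), where λ₁ = 1 + a·(scal − 2·ric 3 3), λ₂ = 1 + a·(scal − 2·ric 2 2), λ₃ = 1 + a·ric 1 1. In particular all eigenvalues of S' are real and positive if and only if λ₁ > 0, λ₂ > 0 and λ₃ > 0. -/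

import Mathlib

open Finset Polynomial

/-- The submodule of symmetric `n × n` real matrices. -/
def symMatrices (n : ℕ) : Submodule ℝ (Matrix (Fin n) (Fin n) ℝ) where
  carrier := {A | A.IsSymm}
  add_mem' := fun ha hb => ha.add hb
  zero_mem' := Matrix.isSymm_zero
  smul_mem' := fun c _ hA => hA.smul c

/-- A symmetric `3 × 3` matrix is determined by its entries on and above the diagonal. -/
def symMatricesThreeEquiv : symMatrices 3 ≃ₗ[ℝ] (Fin 6 → ℝ) where
  toFun h := ![h.1 0 0, h.1 0 1, h.1 0 2, h.1 1 1, h.1 1 2, h.1 2 2]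
  map_add' g h := by ext i; fin_cases i <;> rfl
  map_smul' c h := by ext i; fin_cases i <;> rfl
  invFun v := ⟨!![v 0, v 1, v 2; v 1, v 3, v 4; v 2, v 4, v 5], by
    refine Matrix.IsSymm.ext fun i j => ?_
    fin_cases i <;> fin_cases j <;> rfl⟩
  left_inv h := by
    have hs : ∀ i j, h.1 j i = h.1 i j := fun i j => Matrix.IsSymm.apply h.2 i j
    ext i j
    fin_cases i <;> fin_cases j <;> first | rfl | exact hs _ _
  right_inv v := by ext i; fin_cases i <;> rfl

/-- An endomorphism of symmetric `3 × 3` matrices that acts on coordinates by an upper triangular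
matrix `M` has characteristic polynomial `∏ i, (X - M i i)`. -/
theorem charpoly_eq_prod_of_symMatricesThreeEquiv (f : symMatrices 3 →ₗ[ℝ] symMatrices 3)
    (M : Matrix (Fin 6) (Fin 6) ℝ) (hM : M.IsUpperTriangular)
    (hf : ∀ h, symMatricesThreeEquiv (f h) = M.mulVec (symMatricesThreeEquiv h)) :
    f.charpoly = ∏ i, (X - C (M i i)) := by
  have hconj : symMatricesThreeEquiv.conj f = Matrix.toLin' M := by
    refine LinearMap.ext fun v => ?_
    simp [LinearEquiv.conj_apply, hf]
  rw [← LinearEquiv.charpoly_conj symMatricesThreeEquiv f, hconj, Matrix.charpoly_toLin',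
    Matrix.charpoly_of_isUpperTriangular M hM]

/-- **Characteristic polynomial of the principal symbol of the DeTurck-modified
operator `L − 𝓛_V`.**  Let `R` be an algebraic curvature tensor on `ℝ³`
(components in the standard orthonormal basis; Lean indices `0, 1, 2` correspond
to the indices `1, 2, 3` of the text) with `ric 2 3 = 0`, let `S` be the principal
symbol of the linearized RG²ₐ-flow operator on symmetric `3 × 3` matrices, and
let `S'` be its DeTurck modification.  Then the characteristic polynomial of `S'`
is `(X − 1)³ (X − λ₁)(X − λ₂)(X − λ₃)` with `λ₁ = 1 + a(scal − 2 ric 3 3)`,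
`λ₂ = 1 + a(scal − 2 ric 2 2)`, `λ₃ = 1 + a ric 1 1`; in particular all
eigenvalues of `S'` are real and positive iff `λ₁ > 0`, `λ₂ > 0`, `λ₃ > 0`. -/
theorem charpoly_symbol_DeTurck_RG2a
    (a : ℝ) (R : Fin 3 → Fin 3 → Fin 3 → Fin 3 → ℝ)
    (hR1 : ∀ i j k l, R i j k l = -R j i k l)
    (hR2 : ∀ i j k l, R i j k l = -R i j l k)
    (hR3 : ∀ i j k l, R i j k l = R k l i j)
    (ric : Fin 3 → Fin 3 → ℝ) (hric : ∀ i k, ric i k = ∑ j, R i j k j)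
    (scal : ℝ) (hscal : scal = ∑ i, ric i i)
    (hric23 : ric 1 2 = 0)
    (S : symMatrices 3 →ₗ[ℝ] symMatrices 3)
    (hS : ∀ h : symMatrices 3, ∀ i k,
      (S h : Matrix (Fin 3) (Fin 3) ℝ) i k =
        (h : Matrix (Fin 3) (Fin 3) ℝ) i k
          + (if i = 0 then (1 : ℝ) else 0) * (if k = 0 then (1 : ℝ) else 0) *
              (∑ j, (h : Matrix (Fin 3) (Fin 3) ℝ) j j)
          - (if i = 0 then (1 : ℝ) else 0) * (h : Matrix (Fin 3) (Fin 3) ℝ) 0 k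
          - (if k = 0 then (1 : ℝ) else 0) * (h : Matrix (Fin 3) (Fin 3) ℝ) 0 i
          + a * (if i = 0 then (1 : ℝ) else 0) *
              (∑ s, ∑ u, R k s 0 u * (h : Matrix (Fin 3) (Fin 3) ℝ) s u)
          - a * (∑ u, R k 0 0 u * (h : Matrix (Fin 3) (Fin 3) ℝ) i u)
          + a * (if k = 0 then (1 : ℝ) else 0) *
              (∑ s, ∑ u, R i s 0 u * (h : Matrix (Fin 3) (Fin 3) ℝ) s u)
          - a * (∑ u, R i 0 0 u * (h : Matrix (Fin 3) (Fin 3) ℝ) k u))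
    (S' : symMatrices 3 →ₗ[ℝ] symMatrices 3)
    (hS'11 : ∀ h : symMatrices 3,
      (S' h : Matrix (Fin 3) (Fin 3) ℝ) 0 0 =
        (S h : Matrix (Fin 3) (Fin 3) ℝ) 0 0
          + (h : Matrix (Fin 3) (Fin 3) ℝ) 0 0
          - (h : Matrix (Fin 3) (Fin 3) ℝ) 1 1
          - (h : Matrix (Fin 3) (Fin 3) ℝ) 2 2)
    (hS'1k : ∀ h : symMatrices 3, ∀ k : Fin 3, k ≠ 0 →
      (S' h : Matrix (Fin 3) (Fin 3) ℝ) 0 k =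
        (S h : Matrix (Fin 3) (Fin 3) ℝ) 0 k + (h : Matrix (Fin 3) (Fin 3) ℝ) 0 k)
    (hS'k1 : ∀ h : symMatrices 3, ∀ k : Fin 3, k ≠ 0 →
      (S' h : Matrix (Fin 3) (Fin 3) ℝ) k 0 =
        (S h : Matrix (Fin 3) (Fin 3) ℝ) k 0 + (h : Matrix (Fin 3) (Fin 3) ℝ) k 0)
    (hS'ik : ∀ h : symMatrices 3, ∀ i k : Fin 3, i ≠ 0 → k ≠ 0 →
      (S' h : Matrix (Fin 3) (Fin 3) ℝ) i k = (S h : Matrix (Fin 3) (Fin 3) ℝ) i k) :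
    LinearMap.charpoly S' =
      (X - C 1) ^ 3 * (X - C (1 + a * (scal - 2 * ric 2 2)))
                    * (X - C (1 + a * (scal - 2 * ric 1 1)))
                    * (X - C (1 + a * ric 0 0)) ∧
    ((∀ z : ℂ, ((LinearMap.charpoly S').map (algebraMap ℝ ℂ)).IsRoot z →
        0 < z.re ∧ z.im = 0) ↔
      (0 < 1 + a * (scal - 2 * ric 2 2) ∧ 0 < 1 + a * (scal - 2 * ric 1 1) ∧
        0 < 1 + a * ric 0 0)) := by
  have hanti : ∀ i k l, R i i k l = 0 := fun i k l => by linarith [hR1 i i k l]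
  have hanti' : ∀ i j k, R i j k k = 0 := fun i j k => by linarith [hR2 i j k k]
  have h0102 : R 0 1 0 2 = 0 := by
    have := hric 1 2
    simp only [Fin.sum_univ_three, hanti, hanti', hric23] at this
    linarith [hR1 1 0 2 0, hR2 0 1 2 0]
  have h0201 : R 0 2 0 1 = 0 := by rw [hR3, h0102]
  have hneg : ∀ k u, R k 0 0 u = -R 0 k 0 u := fun k u => hR1 k 0 0 u
  have hric0 : ric 0 0 = R 0 1 0 1 + R 0 2 0 2 := by
    simp [hric, Fin.sum_univ_three, hanti]
  have hric1 : ric 1 1 = R 0 1 0 1 + R 1 2 1 2 := by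
    rw [hric, Fin.sum_univ_three, hanti, hR1 1 0 1 0, hR2 0 1 1 0]; ring
  have hric2 : ric 2 2 = R 0 2 0 2 + R 1 2 1 2 := by
    rw [hric, Fin.sum_univ_three, hanti, hR1 2 0 2 0, hR2 0 2 2 0, hR1 2 1 2 1, hR2 1 2 2 1]; ring
  have hscal' : scal = 2 * (R 0 1 0 1 + R 0 2 0 2 + R 1 2 1 2) := by
    rw [hscal, Fin.sum_univ_three, hric0, hric1, hric2]; ring
  have hchar : LinearMap.charpoly S' =
      (X - C 1) ^ 3 * (X - C (1 + a * (scal - 2 * ric 2 2)))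
                    * (X - C (1 + a * (scal - 2 * ric 1 1)))
                    * (X - C (1 + a * ric 0 0)) := by
    have h1 : 1 + a * (scal - 2 * ric 2 2) = 1 + 2 * a * R 0 1 0 1 := by
      rw [hscal', hric2]; ring
    have h2 : 1 + a * (scal - 2 * ric 1 1) = 1 + 2 * a * R 0 2 0 2 := by
      rw [hscal', hric1]; ring
    rw [h1, h2, hric0, charpoly_eq_prod_of_symMatricesThreeEquiv S'
      !![1, 0, 0, 2 * a * R 0 1 0 1, 0, 2 * a * R 0 2 0 2;
         0, 1, 0, 0, a * R 1 2 0 1, a * R 1 2 0 2;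
         0, 0, 1, a * R 2 1 0 1, a * R 2 1 0 2, 0;
         0, 0, 0, 1 + 2 * a * R 0 1 0 1, 0, 0;
         0, 0, 0, 0, 1 + a * (R 0 1 0 1 + R 0 2 0 2), 0;
         0, 0, 0, 0, 0, 1 + 2 * a * R 0 2 0 2]]
    · simp [Fin.prod_univ_succ]
      ring
    · intro i j hij
      fin_cases i <;> fin_cases j <;> first | rfl | exact absurd hij (by decide)
    · intro h
      have hs : ∀ i j, h.1 j i = h.1 i j := fun i j => Matrix.IsSymm.apply h.2 i j
      have h10 := hs 0 1
      have h20 := hs 0 2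
      have h21 := hs 1 2
      ext i
      fin_cases i <;>
      simp [symMatricesThreeEquiv, Matrix.mulVec, dotProduct, Fin.sum_univ_succ, hS'11, hS'1k,
        hS'ik, hS, hanti, hanti', hneg, h0102, h0201, h10, h20, h21] <;>
      ring
  refine ⟨hchar, ?_⟩
  have hroot : ∀ z : ℂ, ((LinearMap.charpoly S').map (algebraMap ℝ ℂ)).IsRoot z ↔
      z = (1 : ℝ) ∨ z = (1 + a * (scal - 2 * ric 2 2) : ℝ) ∨
        z = (1 + a * (scal - 2 * ric 1 1) : ℝ) ∨ z = (1 + a * ric 0 0 : ℝ) := fun z => by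
    rw [hchar]
    simp only [Polynomial.map_mul, Polynomial.map_pow, Polynomial.map_sub, map_X, map_C,
      IsRoot.def, eval_mul, eval_pow, eval_sub, eval_X, eval_C, mul_eq_zero, sub_eq_zero,
      pow_eq_zero_iff three_ne_zero, Complex.coe_algebraMap, or_assoc]
  simp only [hroot]
  constructor
  · intro hz
    exact ⟨(hz _ (.inr (.inl rfl))).1, (hz _ (.inr (.inr (.inl rfl)))).1,
      (hz _ (.inr (.inr (.inr rfl)))).1⟩
  · rintro ⟨h1, h2, h3⟩ z (rfl | rfl | rfl | rfl)
    exacts [⟨one_pos, rfl⟩, ⟨h1, rfl⟩, ⟨h2, rfl⟩, ⟨h3, rfl⟩]
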